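/- Fix real numbers α < 0 and θ > −α, fix n ∈ ℕ and k ∈ ℕ₀, fix N ∈ ℕ₀, and let (ω_m)_{m ∈ ℕ} be a sequence in ℕ₀ with ω_m → N as m → ∞ (equivalently, ω_m = N for all sufficiently large m). Then lim_{m→∞} d_{n,k}^{m,ω_m} / d^{m,ω_m} = V^{BB,α,θ}_{n,k}(N). (Proposition 2.5(a).) -/

import Mathlib

open scoped BigOperators
open Filter

/-- Rising factorial `(x)_{j↑} = x(x+1)⋯(x+j-1)`. -/
noncomputable def risingFac (x : ℝ) (j : ℕ) : ℝ :=
  ∏ i ∈ Finset.range j, (x + i)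

/-- Falling factorial `(x)_{j↓} = x(x-1)⋯(x-j+1)`. -/
noncomputable def fallingFac (x : ℝ) (j : ℕ) : ℝ :=
  ∏ i ∈ Finset.range j, (x - i)

/-- `S_{n,m} = Σ_{i=1}^{m−n} (α+θ)_{m−i↑} (θ+m−1)_{i−1↓}`. -/
noncomputable def Scot (α θ : ℝ) (n m : ℕ) : ℝ :=
  ∑ i ∈ Finset.Icc 1 (m - n),
    risingFac (α + θ) (m - i) * fallingFac (θ + (m : ℝ) - 1) (i - 1)

/-- `d_{n,k}^{m,l} = C(l,k) ((θ+n)_{m−n↑})^k (S_{n,m})^{l−k}` (equal to `0` when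
`k > l`, since then the binomial coefficient vanishes). -/
noncomputable def dcot (α θ : ℝ) (n k m l : ℕ) : ℝ :=
  (Nat.choose l k : ℝ) * (risingFac (θ + (n : ℝ)) (m - n)) ^ k *
    (Scot α θ n m) ^ (l - k)

/-- `d^{m,l} = ((θ+1)_{m−1↑} + S_{1,m})^l`. -/
noncomputable def dtot (α θ : ℝ) (m l : ℕ) : ℝ :=
  (risingFac (θ + 1) (m - 1) + Scot α θ 1 m) ^ l

/-- Beta–Bernoulli weights `V^{BB,α,θ}_{n,k}(N)`. -/
noncomputable def VBB (α θ : ℝ) (N n k : ℕ) : ℝ :=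
  (Nat.choose N k : ℝ) * ((-α) * Real.Gamma (θ + α) / Real.Gamma (θ + α + n)) ^ k *
    (Real.Gamma (θ + α + n) * Real.Gamma θ /
      (Real.Gamma (θ + α) * Real.Gamma (θ + n))) ^ N

theorem risingFac_succ (x : ℝ) (j : ℕ) : risingFac x (j + 1) = risingFac x j * (x + j) :=
  Finset.prod_range_succ _ _

theorem risingFac_pos {x : ℝ} (hx : 0 < x) (j : ℕ) : 0 < risingFac x j :=
  Finset.prod_pos fun _ _ => by positivity

theorem risingFac_add (x : ℝ) (n j : ℕ) :
    risingFac x (n + j) = risingFac x n * risingFac (x + n) j := by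
  simp only [risingFac, Finset.prod_range_add]
  congr 1
  exact Finset.prod_congr rfl fun i _ => by push_cast; ring

theorem Gamma_add_natCast_eq_risingFac_mul {x : ℝ} (hx : 0 < x) (n : ℕ) :
    Real.Gamma (x + n) = risingFac x n * Real.Gamma x := by
  induction n with
  | zero => simp [risingFac]
  | succ n ih =>
    rw [risingFac_succ, Nat.cast_succ, ← add_assoc, Real.Gamma_add_one (by positivity), ih]
    ring

theorem fallingFac_succ' (x : ℝ) (j : ℕ) :
    fallingFac x (j + 1) = x * fallingFac (x - 1) j := by
  simp only [fallingFac, Finset.prod_range_succ']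
  rw [mul_comm]
  congr 1
  · simp
  · exact Finset.prod_congr rfl fun i _ => by push_cast; ring

theorem Scot_eq_sum_range (α θ : ℝ) (n j : ℕ) :
    Scot α θ n (n + j) = ∑ i ∈ Finset.range j,
      risingFac (α + θ) (n + j - (i + 1)) * fallingFac (θ + ((n + j : ℕ) : ℝ) - 1) i := by
  rw [Scot, Nat.add_sub_cancel_left, ← Finset.Ico_add_one_right_eq_Icc,
    Finset.sum_Ico_eq_sum_range, Nat.add_sub_cancel]
  refine Finset.sum_congr rfl fun i _ => ?_
  rw [Nat.add_sub_cancel_left, Nat.add_comm 1 i]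

theorem Scot_succ (α θ : ℝ) (n j : ℕ) :
    Scot α θ n (n + (j + 1)) =
      risingFac (α + θ) (n + j) + (θ + (n + j : ℕ)) * Scot α θ n (n + j) := by
  rw [Scot_eq_sum_range, Scot_eq_sum_range, Finset.sum_range_succ', add_comm, Finset.mul_sum]
  congr 1
  · simp [fallingFac, ← add_assoc]
  · refine Finset.sum_congr rfl fun i _ => ?_
    rw [fallingFac_succ', show n + (j + 1) - (i + 1 + 1) = n + j - (i + 1) by omega,
      show θ + ((n + (j + 1) : ℕ) : ℝ) - 1 = θ + (n + j : ℕ) by push_cast; ring]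
    ring

/-- Closed form of `S_{n,m}` in terms of rising factorials. -/
theorem Scot_eq {α θ : ℝ} (hα : α ≠ 0) (hθ : 0 < θ) (n j : ℕ) :
    Scot α θ n (n + j) = (risingFac (α + θ) (n + j) -
      risingFac (α + θ) n / risingFac θ n * risingFac θ (n + j)) / α := by
  induction j with
  | zero =>
    have h := (risingFac_pos hθ n).ne'
    simp [Scot, h]
  | succ j ih =>
    rw [Scot_succ, ih, ← add_assoc, risingFac_succ, risingFac_succ]
    field_simp
    ring

theorem tendsto_risingFac_div_risingFac {α θ : ℝ} (hα : α < 0) (hθ : -α < θ) :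
    Tendsto (fun m => risingFac (α + θ) m / risingFac θ m) atTop (nhds 0) := by
  have hθ0 : 0 < θ := by linarith
  have hαθ : 0 < α + θ := by linarith
  rw [← tendsto_add_atTop_iff_nat 1]
  have hpow : Tendsto (fun m : ℕ => (m : ℝ) ^ α) atTop (nhds 0) := by
    simpa [Function.comp_def] using
      (tendsto_rpow_neg_atTop (neg_pos.mpr hα)).comp tendsto_natCast_atTop_atTop
  have hlim := hpow.mul ((Real.GammaSeq_tendsto_Gamma θ).div
    (Real.GammaSeq_tendsto_Gamma (α + θ)) (Real.Gamma_pos_of_pos hαθ).ne')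
  rw [zero_mul] at hlim
  refine hlim.congr' ?_
  filter_upwards [eventually_gt_atTop 0] with m hm
  have hm' : (0 : ℝ) < m := by exact_mod_cast hm
  have h1 := (risingFac_pos hθ0 (m + 1)).ne'
  have h2 := (risingFac_pos hαθ (m + 1)).ne'
  have h3 := (Real.rpow_pos_of_pos hm' θ).ne'
  have h4 := (Real.rpow_pos_of_pos hm' α).ne'
  have h5 : (m.factorial : ℝ) ≠ 0 := by positivity
  simp only [Pi.div_apply, Real.GammaSeq]
  change _ * (_ / risingFac θ (m + 1) / (_ / risingFac (α + θ) (m + 1))) = _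
  rw [Real.rpow_add hm']
  field_simp

/-- Proposition 2.5(a). -/
theorem stmt_18
    (α θ : ℝ) (hα : α < 0) (hθ : -α < θ)
    (n : ℕ) (hn : 1 ≤ n) (k : ℕ) (N : ℕ)
    (ω : ℕ → ℕ)
    (hω : ∀ᶠ m in atTop, ω m = N) :
    Tendsto (fun m : ℕ => dcot α θ n k m (ω m) / dtot α θ m (ω m)) atTop
      (nhds (VBB α θ N n k)) := by
  have hθ0 : 0 < θ := by linarith
  have hαθ : 0 < α + θ := by linarith
  have hP := risingFac_pos hθ0
  have hQ := risingFac_pos hαθ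
  have hG := (Real.Gamma_pos_of_pos hθ0).ne'
  have hG' := (Real.Gamma_pos_of_pos hαθ).ne'
  have hPn := (hP n).ne'
  have hQn := (hQ n).ne'
  rcases lt_or_ge N k with hkN | hkN
  · refine Tendsto.congr' ?_ (tendsto_const_nhds (x := VBB α θ N n k))
    filter_upwards [hω] with m hm
    simp [hm, dcot, VBB, Nat.choose_eq_zero_of_lt hkN]
  have hV : VBB α θ N n k = N.choose k * (-α / risingFac θ n / (1 - 0)) ^ k *
      ((risingFac (α + θ) n / risingFac θ n - 0) / (1 - 0)) ^ (N - k) := by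
    obtain ⟨l, rfl⟩ := Nat.exists_eq_add_of_le hkN
    have hq : risingFac (α + θ) n * Real.Gamma (α + θ) * Real.Gamma θ /
        (Real.Gamma (α + θ) * (risingFac θ n * Real.Gamma θ)) =
        risingFac (α + θ) n / risingFac θ n := by
      field_simp
    have hp : -α * Real.Gamma (α + θ) / (risingFac (α + θ) n * Real.Gamma (α + θ)) *
        (risingFac (α + θ) n / risingFac θ n) = -α / risingFac θ n := by
      field_simp
    rw [VBB, add_comm θ α, Gamma_add_natCast_eq_risingFac_mul hθ0,
      Gamma_add_natCast_eq_risingFac_mul hαθ, hq, Nat.add_sub_cancel_left, pow_add, ← mul_assoc,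
      mul_assoc (_ : ℝ) (_ ^ k) (_ ^ k), ← mul_pow, hp]
    simp only [sub_zero, div_one]
  rw [hV]
  have hr := tendsto_risingFac_div_risingFac hα hθ
  have hden := hr.const_sub 1
  have hlim := (((tendsto_const_nhds (x := -α / risingFac θ n)).div hden (by norm_num)).pow k
    |>.const_mul (N.choose k : ℝ)).mul
    (((hr.const_sub (risingFac (α + θ) n / risingFac θ n)).div hden (by norm_num)).pow (N - k))
  refine hlim.congr' ?_
  filter_upwards [hω, eventually_ge_atTop n] with m hm hnm
  have hPm := (hP m).ne'
  have hrise : risingFac (θ + n) (m - n) = risingFac θ m * (1 / risingFac θ n) := by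
    have := risingFac_add θ n (m - n)
    rw [Nat.add_sub_cancel' hnm] at this
    rw [this]
    field_simp
  have hS : ∀ p ≤ m, Scot α θ p m = risingFac θ m / -α * (risingFac (α + θ) p / risingFac θ p -
      risingFac (α + θ) m / risingFac θ m) := by
    intro p hp
    have h := Scot_eq hα.ne hθ0 p (m - p)
    have hPp := (hP p).ne'
    rw [Nat.add_sub_cancel' hp] at h
    rw [h]
    have := hα.ne
    field_simp
    ring
  have htot : risingFac (θ + 1) (m - 1) + Scot α θ 1 m =
      risingFac θ m / -α * (1 - risingFac (α + θ) m / risingFac θ m) := by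
    have h := risingFac_add θ 1 (m - 1)
    rw [Nat.add_sub_cancel' (hn.trans hnm)] at h
    have h1 : ∀ x : ℝ, risingFac x 1 = x := fun x => by simp [risingFac]
    have h' : risingFac (θ + 1) (m - 1) = risingFac θ m / θ := by
      rw [h, h1, Nat.cast_one]
      field_simp
    rw [hS 1 (hn.trans hnm), h', h1, h1]
    have := hα.ne
    field_simp
    ring
  have hc : risingFac θ m / -α ≠ 0 := div_ne_zero hPm (neg_ne_zero.mpr hα.ne)
  have hrise' : risingFac (θ + n) (m - n) = risingFac θ m / -α * (-α / risingFac θ n) := by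
    rw [hrise]
    have := hα.ne
    field_simp
  rw [hm, dcot, dtot, htot, hS n hnm, hrise', ← pow_mul_pow_sub _ hkN, mul_div_mul_comm,
    mul_div_assoc (N.choose k : ℝ), ← div_pow, ← div_pow, mul_div_mul_left _ _ hc,
    mul_div_mul_left _ _ hc]
  rfl
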